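/- For every integer N ≥ 257 there exists a real polynomial g ∈ ℝ[x₁,x₂,x₃] with non-negative coefficients such that g(x₁,x₂,x₃) = 1 whenever x₁ + x₂ + x₃ = 1, every triple (a,b,c) ∈ ℕ³ in the support of g satisfies 7 ∣ a + 2b + 4c, and the support of g has exactly N elements. -/

import Mathlib

open MvPolynomial

/-- A state of the tensoring process: `h + c * x₁^(7 d)` is an invariant polynomial with
non-negative coefficients, equal to `1` on the plane, where every monomial of `h` has
`x₁`-degree less than `7 d` and `h` has exactly `r` monomials. -/
def GoodState (d r : ℕ) (h : MvPolynomial (Fin 3) ℝ) (c : ℝ) : Prop :=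
  0 < c ∧ (∀ α, 0 ≤ h.coeff α) ∧
  (∀ x₁ x₂ x₃ : ℝ, x₁ + x₂ + x₃ = 1 →
    eval ![x₁, x₂, x₃] h + c * x₁ ^ (7 * d) = 1) ∧
  (∀ α ∈ h.support, 7 ∣ α 0 + 2 * α 1 + 4 * α 2) ∧
  (∀ α ∈ h.support, α 0 < 7 * d) ∧
  h.support.card = r

lemma goodState_of_terms (n : ℕ) (e : Fin n → Fin 3 → ℕ) (v : Fin n → ℝ) (c : ℝ) (hc : 0 < c)
    (he : Function.Injective e) (hv : ∀ i, 0 < v i)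
    (hdvd : ∀ i, 7 ∣ e i 0 + 2 * e i 1 + 4 * e i 2) (hlt : ∀ i, e i 0 < 7)
    (hev : ∀ x₁ x₂ x₃ : ℝ, x₁ + x₂ + x₃ = 1 →
      ∑ i, v i * (x₁ ^ e i 0 * x₂ ^ e i 1 * x₃ ^ e i 2) + c * x₁ ^ 7 = 1) :
    GoodState 1 n (∑ i, monomial (Finsupp.equivFunOnFinite.symm (e i)) (v i)) c := by
  set E : Fin n → (Fin 3 →₀ ℕ) := fun i => Finsupp.equivFunOnFinite.symm (e i) with hE
  have hEi : Function.Injective E := fun i j hij =>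
    he (Finsupp.equivFunOnFinite.symm.injective hij)
  have hcoeff : ∀ α, coeff α (∑ i, monomial (E i) (v i)) = ∑ i, if E i = α then v i else 0 := by
    intro α
    simp [coeff_sum, coeff_monomial]
  have hsupp : (∑ i, monomial (E i) (v i)).support = Finset.univ.image E := by
    ext α
    rw [mem_support_iff, hcoeff]
    simp only [Finset.mem_image, Finset.mem_univ, true_and]
    constructor
    · intro h
      by_contra hne
      push Not at hne
      exact h (Finset.sum_eq_zero fun i _ => by simp [hne i])
    · rintro ⟨i, rfl⟩
      have : ∑ j, (if E j = E i then v j else 0) = v i := by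
        simp [hEi.eq_iff]
      rw [this]
      exact (hv i).ne'
  refine ⟨hc, ?_, ?_, ?_, ?_, ?_⟩
  · intro α
    rw [hcoeff]
    exact Finset.sum_nonneg fun i _ => by split_ifs <;> [exact (hv i).le; exact le_rfl]
  · intro x₁ x₂ x₃ hx
    rw [← hev x₁ x₂ x₃ hx]
    simp [eval_monomial, Finsupp.prod_fintype, Fin.prod_univ_three]
  · rw [hsupp]
    intro α hα
    obtain ⟨i, -, rfl⟩ := Finset.mem_image.1 hα
    simpa [hE] using hdvd i
  · rw [hsupp]
    intro α hα
    obtain ⟨i, -, rfl⟩ := Finset.mem_image.1 hα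
    simpa [hE] using hlt i
  · rw [hsupp, Finset.card_image_of_injective _ hEi]
    simp

lemma goodState_step {d r m : ℕ} {h P : MvPolynomial (Fin 3) ℝ} {c l : ℝ}
    (H : GoodState d r h c) (K : GoodState 1 m P l) :
    GoodState (d + 1) (r + m)
      (h + monomial (Finsupp.single 0 (7 * d)) c * P) (c * l) := by
  obtain ⟨hc, h0, hev, hdvd, hlt, hcard⟩ := H
  obtain ⟨kc, k0, kev, kdvd, klt, kcard⟩ := K
  set s : Fin 3 →₀ ℕ := Finsupp.single 0 (7 * d) with hs
  have hsupp : (monomial s c * P).support = P.support.map (addLeftEmbedding s) := by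
    ext α
    rw [mem_support_iff, coeff_monomial_mul']
    simp only [Finset.mem_map, addLeftEmbedding_apply]
    constructor
    · intro hh
      split_ifs at hh with hle
      · exact ⟨α - s, mem_support_iff.2 (right_ne_zero_of_mul hh), add_tsub_cancel_of_le hle⟩
      · exact absurd rfl hh
    · rintro ⟨β, hβ, rfl⟩
      rw [if_pos le_self_add, add_tsub_cancel_left]
      exact mul_ne_zero hc.ne' (mem_support_iff.1 hβ)
  have hdisj : Disjoint h.support (monomial s c * P).support := by
    rw [Finset.disjoint_left]
    intro α hα hα'
    rw [hsupp] at hα'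
    obtain ⟨β, -, rfl⟩ := Finset.mem_map.1 hα'
    have := hlt _ hα
    simp [hs] at this
  have hun : (h + monomial s c * P).support = h.support ∪ (monomial s c * P).support :=
    Finsupp.support_add_eq hdisj
  refine ⟨mul_pos hc kc, ?_, ?_, ?_, ?_, ?_⟩
  · intro α
    rw [coeff_add, coeff_monomial_mul']
    refine add_nonneg (h0 α) ?_
    split_ifs
    · exact mul_nonneg hc.le (k0 _)
    · exact le_rfl
  · intro x₁ x₂ x₃ hx
    have h1 := hev x₁ x₂ x₃ hx
    have h2 := kev x₁ x₂ x₃ hx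
    have h3 : eval ![x₁, x₂, x₃] (monomial s c) = c * x₁ ^ (7 * d) := by
      rw [hs, eval_monomial, Finsupp.prod_single_index (by simp)]
      simp
    rw [map_add, map_mul, h3, mul_add, pow_add]
    linear_combination h1 + c * x₁ ^ (7 * d) * h2
  · rw [hun, hsupp]
    intro α hα
    rcases Finset.mem_union.1 hα with hα | hα
    · exact hdvd α hα
    · obtain ⟨β, hβ, rfl⟩ := Finset.mem_map.1 hα
      have := kdvd β hβ
      simp [hs]
      omega
  · rw [hun, hsupp]
    intro α hα
    rcases Finset.mem_union.1 hα with hα | hα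
    · have := hlt α hα
      omega
    · obtain ⟨β, hβ, rfl⟩ := Finset.mem_map.1 hα
      have := klt β hβ
      simp [hs]
      omega
  · rw [hun, Finset.card_union_of_disjoint hdisj, hsupp, Finset.card_map, hcard, kcard]

/-- The canonical polynomial with `x₁^7` removed. -/
lemma goodState_full : ∃ P l, GoodState 1 16 P l := by
  refine ⟨_, _, goodState_of_terms 16
    ![![0, 0, 7], ![0, 1, 3], ![0, 3, 2], ![0, 5, 1], ![0, 7, 0], ![1, 0, 5], ![1, 1, 1],
      ![1, 2, 4], ![1, 3, 0], ![2, 0, 3], ![2, 2, 2], ![2, 4, 1], ![3, 0, 1], ![3, 2, 0],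
      ![4, 1, 2], ![5, 1, 0]]
    ![1, 7, 14, 7, 1, 7, 14, 7, 7, 14, 7, 7, 7, 14, 7, 7] 1 one_pos (by decide) ?_ (by decide)
    (by decide) ?_⟩
  · intro i
    fin_cases i <;> simp
  · intro x₁ x₂ x₃ hx
    obtain rfl : x₃ = 1 - x₁ - x₂ := by linarith
    simp [Fin.sum_univ_succ]
    ring

lemma goodState_half : ∃ P l, GoodState 1 17 P l := by
  refine ⟨_, _, goodState_of_terms 17
    ![![0, 0, 0], ![0, 0, 7], ![0, 1, 3], ![0, 3, 2], ![0, 5, 1], ![0, 7, 0], ![1, 0, 5],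
      ![1, 1, 1], ![1, 2, 4], ![1, 3, 0], ![2, 0, 3], ![2, 2, 2], ![2, 4, 1], ![3, 0, 1],
      ![3, 2, 0], ![4, 1, 2], ![5, 1, 0]]
    ![1/2, 1/2, 7/2, 7, 7/2, 1/2, 7/2, 7, 7/2, 7/2, 7, 7/2, 7/2, 7/2, 7, 7/2, 7/2] (1/2)
    (by norm_num) (by decide) ?_ (by decide) (by decide) ?_⟩
  · intro i
    fin_cases i <;> simp
  · intro x₁ x₂ x₃ hx
    obtain rfl : x₃ = 1 - x₁ - x₂ := by linarith
    simp [Fin.sum_univ_succ]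
    ring

lemma goodState_exists (a b : ℕ) : ∃ h c, GoodState (a + b) (16 * a + 17 * b) h c := by
  obtain ⟨P, l, hP⟩ := goodState_full
  obtain ⟨Q, k, hQ⟩ := goodState_half
  induction a with
  | zero =>
    induction b with
    | zero => exact ⟨0, 1, by simp [GoodState]⟩
    | succ b ih =>
      obtain ⟨h, c, H⟩ := ih
      have := goodState_step H hQ
      rw [show 0 + b + 1 = 0 + (b + 1) by ring,
        show 16 * 0 + 17 * b + 17 = 16 * 0 + 17 * (b + 1) by ring] at this
      exact ⟨_, _, this⟩
  | succ a ih =>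
    obtain ⟨h, c, H⟩ := ih
    have := goodState_step H hP
    rw [show a + b + 1 = a + 1 + b by ring,
      show 16 * a + 17 * b + 16 = 16 * (a + 1) + 17 * b by ring] at this
    exact ⟨_, _, this⟩

/-- For every `N ≥ 257 = 17² − 2·17 + 2` there is a polynomial in three variables
with non-negative coefficients, equal to `1` on `x₁ + x₂ + x₃ = 1`, invariant
under `Γ(7,2,4) = ⟨ωI₁ ⊕ ω²I₁ ⊕ ω⁴I₁⟩` for `ω` a primitive 7-th root of unity
(`7 ∣ a + 2b + 4c` on the support), with support of cardinality exactly `N`. -/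
theorem stmt_13 (N : ℕ) (hN : 257 ≤ N) :
    ∃ g : MvPolynomial (Fin 3) ℝ,
      (∀ α, 0 ≤ g.coeff α) ∧
      (∀ x₁ x₂ x₃ : ℝ, x₁ + x₂ + x₃ = 1 → eval ![x₁, x₂, x₃] g = 1) ∧
      (∀ α ∈ g.support, 7 ∣ α 0 + 2 * α 1 + 4 * α 2) ∧
      g.support.card = N := by
  obtain ⟨a, b, hab⟩ : ∃ a b, N = 16 * a + 17 * b + 1 :=
    ⟨(N - 1) / 16 - (N - 1) % 16, (N - 1) % 16, by omega⟩
  obtain ⟨h, c, hc, h0, hev, hdvd, hlt, hcard⟩ := goodState_exists a b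
  set s : Fin 3 →₀ ℕ := Finsupp.single 0 (7 * (a + b)) with hs
  have hsupp : (monomial s c).support = {s} := by
    classical
    rw [support_monomial, if_neg hc.ne']
  have hdisj : Disjoint h.support (monomial s c).support := by
    rw [hsupp, Finset.disjoint_singleton_right]
    intro hα
    have := hlt _ hα
    simp [hs] at this
  have hun : (h + monomial s c).support = h.support ∪ (monomial s c).support :=
    Finsupp.support_add_eq hdisj
  refine ⟨h + monomial s c, ?_, ?_, ?_, ?_⟩
  · intro α
    classical
    rw [coeff_add, coeff_monomial]
    refine add_nonneg (h0 α) ?_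
    split_ifs
    · exact hc.le
    · exact le_rfl
  · intro x₁ x₂ x₃ hx
    rw [← hev x₁ x₂ x₃ hx]
    rw [map_add, hs, eval_monomial, Finsupp.prod_single_index (by simp)]
    simp
  · rw [hun, hsupp]
    intro α hα
    rcases Finset.mem_union.1 hα with hα | hα
    · exact hdvd α hα
    · obtain rfl := Finset.mem_singleton.1 hα
      simp [hs]
  · rw [hun, Finset.card_union_of_disjoint hdisj, hsupp, hcard, hab]
    simp
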